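/- arXiv:1610.05474 — 8 statements merged into one kernel-verified Lean document; each statement's English description precedes it below -/
import Mathlib

section
/- The ring Pol(SU_{-1}(2)) is a domain: it is a nontrivial ring, and for all x, y ∈ Pol(SU_{-1}(2)), if x·y = 0 then x = 0 or y = 0. -/
/-- Generators of `Pol(SU_{-1}(2))`: `a`, `as`, `g`, `gs` represent `α`, `α*`, `γ`, `γ*`. -/
inductive SUgen : Type
  | a | as | g | gs

open FreeAlgebra SUgen in
/-- The defining relations of `Pol(SU_{-1}(2))`. -/
inductive SUrel : FreeAlgebra ℂ SUgen → FreeAlgebra ℂ SUgen → Prop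
  | r1 : SUrel (ι ℂ as * ι ℂ a + ι ℂ gs * ι ℂ g - 1) 0
  | r2 : SUrel (ι ℂ a * ι ℂ as + ι ℂ g * ι ℂ gs - 1) 0
  | r3 : SUrel (ι ℂ g * ι ℂ gs - ι ℂ gs * ι ℂ g) 0
  | r4 : SUrel (ι ℂ a * ι ℂ g + ι ℂ g * ι ℂ a) 0
  | r5 : SUrel (ι ℂ a * ι ℂ gs + ι ℂ gs * ι ℂ a) 0
  | r6 : SUrel (ι ℂ gs * ι ℂ as + ι ℂ as * ι ℂ gs) 0
  | r7 : SUrel (ι ℂ g * ι ℂ as + ι ℂ as * ι ℂ g) 0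

/-- `Pol(SU_{-1}(2))`: the universal unital `ℂ`-algebra on `α, α*, γ, γ*` with the above
relations, i.e. the quotient of the free algebra by the two-sided ideal they generate. -/
noncomputable abbrev PolSU : Type := RingQuot SUrel

/-- The generator `α`. -/
noncomputable def SUα : PolSU := RingQuot.mkAlgHom ℂ SUrel (FreeAlgebra.ι ℂ SUgen.a)

/-- The generator `α*`. -/
noncomputable def SUαs : PolSU := RingQuot.mkAlgHom ℂ SUrel (FreeAlgebra.ι ℂ SUgen.as)

/-- The generator `γ`. -/
noncomputable def SUγ : PolSU := RingQuot.mkAlgHom ℂ SUrel (FreeAlgebra.ι ℂ SUgen.g)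

/-- The generator `γ*`. -/
noncomputable def SUγs : PolSU := RingQuot.mkAlgHom ℂ SUrel (FreeAlgebra.ι ℂ SUgen.gs)

namespace SkewMonoidAlgebra

variable {k G : Type*} [Semiring k] [Monoid G] [MulSemiringAction G k]

theorem coeff_mul_mul_of_uniqueMul {f g : SkewMonoidAlgebra k G} {a b : G}
    (h : UniqueMul f.support g.support a b) :
    (f * g).coeff (a * b) = f.coeff a * a • g.coeff b := by
  classical
  simp only [coeff_mul, sum_def, Finsupp.sum, ← Finset.sum_product', support_coeff]
  refine (Finset.sum_eq_single (a, b) ?_ ?_).trans (if_pos rfl) <;>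
    simp_rw [Finset.mem_product]
  · refine fun ab hab hne ↦ if_neg fun he ↦ hne <| Prod.ext ?_ ?_
    exacts [(h hab.1 hab.2 he).1, (h hab.1 hab.2 he).2]
  · refine fun hnotMem ↦ ite_eq_right_iff.mpr fun _ ↦ ?_
    rcases not_and_or.mp hnotMem with hf | hg
    · rw [notMem_support_iff.mp hf, zero_mul]
    · rw [notMem_support_iff.mp hg, smul_zero, mul_zero]

/-- A skew group algebra over a ring without zero divisors has no zero divisors if the group has
the unique products property. -/
theorem noZeroDivisors {k G : Type*} [Semiring k] [NoZeroDivisors k] [Group G]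
    [UniqueProds G] [MulSemiringAction G k] : NoZeroDivisors (SkewMonoidAlgebra k G) where
  eq_zero_or_eq_zero_of_mul_eq_zero {a b} hab := by
    contrapose! hab
    simp only [ne_eq, ← support_eq_empty, ← Finset.nonempty_iff_ne_empty] at hab ⊢
    obtain ⟨x, hx, y, hy, h⟩ := UniqueProds.uniqueMul_of_nonempty hab.1 hab.2
    refine ⟨x * y, ?_⟩
    rw [mem_support_iff] at hx hy ⊢
    rw [coeff_mul_mul_of_uniqueMul h]
    exact mul_ne_zero hx ((smul_ne_zero_iff_ne x).mpr hy)

end SkewMonoidAlgebra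

namespace PolSU

open Polynomial

/-- The polynomial ring `ℂ[γ, γ*]`, with `γ = C X` and `γ* = X`. -/
abbrev Coeff : Type := ℂ[X][X]

theorem Coeff.induction {P : Coeff → Prop} (hC : ∀ c : ℂ, P (C (C c))) (hX : P (C X)) (hY : P X)
    (hadd : ∀ p q, P p → P q → P (p + q)) (hmul : ∀ p q, P p → P q → P (p * q)) (p : Coeff) :
    P p := by
  have pow (q : Coeff) (hq : P q) (n : ℕ) : P (q ^ n) := by
    induction n with
    | zero => simpa using hC 1
    | succ n ih => rw [pow_succ]; exact hmul _ _ ih hq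
  induction p using Polynomial.induction_on' with
  | add p q hp hq => exact hadd p q hp hq
  | monomial n p =>
    rw [← C_mul_X_pow_eq_monomial]
    refine hmul _ _ ?_ (pow _ hY n)
    induction p using Polynomial.induction_on' with
    | add p q hp hq => rw [C_add]; exact hadd _ _ hp hq
    | monomial m c =>
      rw [← C_mul_X_pow_eq_monomial, C_mul, C_pow]
      exact hmul _ _ (hC c) (pow _ hX m)

/-- The sign change `γ ↦ -γ`, `γ* ↦ -γ*` as an algebra endomorphism. -/
noncomputable def signHom : Coeff →ₐ[ℂ] Coeff :=
  { eval₂RingHom (C.comp (aeval (-X : ℂ[X]) : ℂ[X] →ₐ[ℂ] ℂ[X]).toRingHom) (-X) with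
    commutes' := fun c ↦ by simp [Polynomial.algebraMap_apply] }

@[simp] theorem signHom_C_C (c : ℂ) : signHom (C (C c)) = C (C c) := by simp [signHom]

@[simp] theorem signHom_C_X : signHom (C X) = -(C X : Coeff) := by simp [signHom]

@[simp] theorem signHom_X : signHom X = -X := by simp [signHom]

theorem signHom_signHom (p : Coeff) : signHom (signHom p) = p := by
  induction p using Coeff.induction with
  | hC c => simp
  | hX => simp
  | hY => simp
  | hadd p q hp hq => simp [hp, hq]
  | hmul p q hp hq => simp [hp, hq]

/-- The sign change `γ ↦ -γ`, `γ* ↦ -γ*` as an automorphism. -/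
noncomputable def sign : Coeff ≃ₐ[ℂ] Coeff :=
  AlgEquiv.ofAlgHom signHom signHom (AlgHom.ext signHom_signHom) (AlgHom.ext signHom_signHom)

/-- `ℤ` acts on `ℂ[γ, γ*]` through powers of the sign change. -/
noncomputable instance : MulSemiringAction (Multiplicative ℤ) Coeff :=
  MulSemiringAction.compHom Coeff (zpowersHom (Coeff ≃ₐ[ℂ] Coeff) sign)

theorem smul_def (n : Multiplicative ℤ) (p : Coeff) : n • p = (sign ^ n.toAdd) p := rfl

@[simp] theorem ofAdd_one_smul (p : Coeff) : Multiplicative.ofAdd (1 : ℤ) • p = signHom p := rfl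

@[simp] theorem ofAdd_neg_one_smul (p : Coeff) :
    Multiplicative.ofAdd (-1 : ℤ) • p = signHom p := rfl

instance : SMulCommClass (Multiplicative ℤ) ℂ Coeff where
  smul_comm n c p := by simp only [smul_def, map_smul]

/-- The skew Laurent polynomial ring over `ℂ[γ, γ*]`. -/
abbrev SkewLaurent : Type := SkewMonoidAlgebra Coeff (Multiplicative ℤ)

/-- The element `1 - γγ*`, equal to both `αα*` and `α*α`. -/
noncomputable def normα : Coeff := 1 - C X * X

@[simp] theorem signHom_normα : signHom normα = normα := by
  simp only [normα, map_sub, map_one, map_mul, signHom_C_X, signHom_X]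
  ring

theorem normα_ne_zero : normα ≠ 0 := by
  intro h
  simpa [normα] using congr_arg (eval 0) h

open SkewMonoidAlgebra

/-- The images of the generators in the skew Laurent polynomial ring. -/
noncomputable def genImage : SUgen → SkewLaurent
  | .a => single (Multiplicative.ofAdd 1) 1
  | .as => single (Multiplicative.ofAdd (-1)) normα
  | .g => single 1 (C X)
  | .gs => single 1 X

/-- The homomorphism from `Pol(SU_{-1}(2))` to skew Laurent polynomials. -/
noncomputable def toSkewLaurent : PolSU →ₐ[ℂ] SkewLaurent :=
  RingQuot.liftAlgHom ℂ ⟨FreeAlgebra.lift ℂ genImage, by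
    intro x y h
    have hinv : (Multiplicative.ofAdd (-1 : ℤ)) * Multiplicative.ofAdd 1 = 1 := rfl
    have hinv' : (Multiplicative.ofAdd (1 : ℤ)) * Multiplicative.ofAdd (-1) = 1 := rfl
    cases h
    all_goals
      simp only [map_add, map_sub, map_mul, map_one, map_zero, FreeAlgebra.lift_ι_apply, genImage,
        single_mul_single, hinv, hinv', ofAdd_one_smul, ofAdd_neg_one_smul, signHom_normα, one_smul,
        mul_one, one_mul, signHom_C_X, signHom_X, one_def, ← single_add, single_eq_zero]
    case r1 | r2 => exact sub_eq_zero.mpr (congr_arg _ (by rw [normα]; ring))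
    case r3 => exact sub_eq_zero.mpr (congr_arg _ (mul_comm _ _))
    all_goals ring⟩

@[simp] theorem toSkewLaurent_α :
    toSkewLaurent SUα = single (Multiplicative.ofAdd 1) 1 := by
  simp [toSkewLaurent, SUα, genImage]

@[simp] theorem toSkewLaurent_αs :
    toSkewLaurent SUαs = single (Multiplicative.ofAdd (-1)) normα := by
  simp [toSkewLaurent, SUαs, genImage]

@[simp] theorem toSkewLaurent_γ : toSkewLaurent SUγ = single 1 (C X) := by
  simp [toSkewLaurent, SUγ, genImage]

@[simp] theorem toSkewLaurent_γs : toSkewLaurent SUγs = single 1 X := by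
  simp [toSkewLaurent, SUγs, genImage]

theorem αs_mul_α : SUαs * SUα = 1 - SUγs * SUγ := by
  have h := RingQuot.mkAlgHom_rel ℂ SUrel.r1
  simp only [map_add, map_sub, map_mul, map_one, map_zero] at h
  exact eq_sub_of_add_eq (sub_eq_zero.mp h)

theorem α_mul_αs : SUα * SUαs = 1 - SUγ * SUγs := by
  have h := RingQuot.mkAlgHom_rel ℂ SUrel.r2
  simp only [map_add, map_sub, map_mul, map_one, map_zero] at h
  exact eq_sub_of_add_eq (sub_eq_zero.mp h)

theorem γ_mul_γs : SUγ * SUγs = SUγs * SUγ := by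
  have h := RingQuot.mkAlgHom_rel ℂ SUrel.r3
  simp only [map_sub, map_mul, map_zero] at h
  exact sub_eq_zero.mp h

theorem γ_mul_α : SUγ * SUα = -(SUα * SUγ) := by
  have h := RingQuot.mkAlgHom_rel ℂ SUrel.r4
  simp only [map_add, map_mul, map_zero] at h
  exact eq_neg_of_add_eq_zero_right h

theorem γs_mul_α : SUγs * SUα = -(SUα * SUγs) := by
  have h := RingQuot.mkAlgHom_rel ℂ SUrel.r5
  simp only [map_add, map_mul, map_zero] at h
  exact eq_neg_of_add_eq_zero_right h

theorem γs_mul_αs : SUγs * SUαs = -(SUαs * SUγs) := by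
  have h := RingQuot.mkAlgHom_rel ℂ SUrel.r6
  simp only [map_add, map_mul, map_zero] at h
  exact eq_neg_of_add_eq_zero_left h

theorem γ_mul_αs : SUγ * SUαs = -(SUαs * SUγ) := by
  have h := RingQuot.mkAlgHom_rel ℂ SUrel.r7
  simp only [map_add, map_mul, map_zero] at h
  exact eq_neg_of_add_eq_zero_left h

/-- The homomorphism `ℂ[γ, γ*] → Pol(SU_{-1}(2))`. -/
noncomputable def ofCoeffs : Coeff →+* PolSU :=
  eval₂RingHom' (aeval SUγ : ℂ[X] →ₐ[ℂ] PolSU).toRingHom SUγs fun p ↦ by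
    have h : Commute SUγ SUγs := γ_mul_γs
    induction p using Polynomial.induction_on' with
    | add p q hp hq => rw [map_add]; exact hp.add_left hq
    | monomial n c =>
      simpa [aeval_monomial] using
        (Algebra.commute_algebraMap_left c SUγs).mul_left (h.pow_left n)

@[simp] theorem ofCoeffs_C_C (c : ℂ) : ofCoeffs (C (C c)) = algebraMap ℂ PolSU c := by
  simp [ofCoeffs]

@[simp] theorem ofCoeffs_C_X : ofCoeffs (C X) = SUγ := by simp [ofCoeffs]

@[simp] theorem ofCoeffs_X : ofCoeffs X = SUγs := by simp [ofCoeffs]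

theorem α_mul_αs_eq : SUα * SUαs = ofCoeffs normα := by simp [normα, α_mul_αs]

theorem αs_mul_α_eq : SUαs * SUα = ofCoeffs normα := by simp [normα, αs_mul_α, γ_mul_γs]

/-- An element anticommuting with `γ` and `γ*` commutes with `ℂ[γ, γ*]` up to the sign change. -/
theorem ofCoeffs_mul_of_anticommute {z : PolSU} (h : SUγ * z = -(z * SUγ))
    (hs : SUγs * z = -(z * SUγs)) (p : Coeff) : ofCoeffs p * z = z * ofCoeffs (signHom p) := by
  induction p using Coeff.induction with
  | hC c => simpa using Algebra.commutes c z
  | hX =>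
    rw [ofCoeffs_C_X, signHom_C_X, map_neg, ofCoeffs_C_X]
    exact h.trans (mul_neg z SUγ).symm
  | hY =>
    rw [ofCoeffs_X, signHom_X, map_neg, ofCoeffs_X]
    exact hs.trans (mul_neg z SUγs).symm
  | hadd p q hp hq => simp [add_mul, mul_add, hp, hq]
  | hmul p q hp hq => rw [map_mul, mul_assoc, hq, ← mul_assoc, hp, mul_assoc, map_mul, map_mul]

theorem ofCoeffs_mul_pow_of_anticommute {z : PolSU} (h : SUγ * z = -(z * SUγ))
    (hs : SUγs * z = -(z * SUγs)) (n : ℕ) (p : Coeff) :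
    ofCoeffs p * z ^ n = z ^ n * ofCoeffs (signHom^[n] p) := by
  induction n generalizing p with
  | zero => simp
  | succ n ih =>
    rw [pow_succ', ← mul_assoc, ofCoeffs_mul_of_anticommute h hs, mul_assoc, ih, mul_assoc,
      Function.iterate_succ_apply]

theorem iterate_signHom_normα (n : ℕ) : signHom^[n] normα = normα :=
  Function.iterate_fixed signHom_normα n

theorem toSkewLaurent_ofCoeffs (p : Coeff) : toSkewLaurent (ofCoeffs p) = single 1 p := by
  induction p using Coeff.induction with
  | hC c => simp [Polynomial.algebraMap_apply]
  | hX => simp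
  | hY => simp
  | hadd p q hp hq => simp [hp, hq, single_add]
  | hmul p q hp hq => simp [hp, hq, single_mul_single]

/-- The power `α ^ k`, where negative powers of `α` are read as powers of `α*`. -/
noncomputable def αPow : ℤ → PolSU
  | .ofNat n => SUα ^ n
  | .negSucc n => SUαs ^ (n + 1)

theorem ofCoeffs_mul_αPow (p : Coeff) (k : ℤ) :
    ∃ q, ofCoeffs p * αPow k = αPow k * ofCoeffs q := by
  cases k with
  | ofNat n => exact ⟨_, ofCoeffs_mul_pow_of_anticommute γ_mul_α γs_mul_α n p⟩
  | negSucc n => exact ⟨_, ofCoeffs_mul_pow_of_anticommute γ_mul_αs γs_mul_αs (n + 1) p⟩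

theorem α_mul_αPow (k : ℤ) : ∃ q, SUα * αPow k = αPow (k + 1) * ofCoeffs q := by
  cases k with
  | ofNat n => exact ⟨1, by rw [map_one, mul_one]; exact (pow_succ' SUα n).symm⟩
  | negSucc n =>
    refine ⟨normα, ?_⟩
    have h : αPow (Int.negSucc n + 1) = SUαs ^ n := by
      cases n with
      | zero => simp [αPow]
      | succ n => rfl
    rw [h, αPow, pow_succ', ← mul_assoc, α_mul_αs_eq,
      ofCoeffs_mul_pow_of_anticommute γ_mul_αs γs_mul_αs, iterate_signHom_normα]

theorem αs_mul_αPow (k : ℤ) : ∃ q, SUαs * αPow k = αPow (k - 1) * ofCoeffs q := by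
  cases k with
  | ofNat n =>
    cases n with
    | zero =>
      refine ⟨1, ?_⟩
      rw [map_one, mul_one, show Int.ofNat 0 - 1 = Int.negSucc 0 from rfl]
      simp [αPow]
    | succ n =>
      refine ⟨normα, ?_⟩
      have h : αPow (Int.ofNat (n + 1) - 1) = SUα ^ n := by
        rw [show Int.ofNat (n + 1) - 1 = Int.ofNat n by simp]; rfl
      rw [h, αPow, pow_succ', ← mul_assoc, αs_mul_α_eq,
        ofCoeffs_mul_pow_of_anticommute γ_mul_α γs_mul_α, iterate_signHom_normα]
  | negSucc n =>
    refine ⟨1, ?_⟩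
    rw [show Int.negSucc n - 1 = Int.negSucc (n + 1) from rfl, map_one, mul_one]
    exact (pow_succ' SUαs (n + 1)).symm

theorem toSkewLaurent_αPow (k : ℤ) :
    ∃ p ≠ 0, toSkewLaurent (αPow k) = single (Multiplicative.ofAdd k) p := by
  have key (z : PolSU) (m : ℤ) (q : Coeff) (hq : q ≠ 0)
      (hz : toSkewLaurent z = single (Multiplicative.ofAdd m) q) (n : ℕ) :
      ∃ p ≠ 0, toSkewLaurent (z ^ n) = single (Multiplicative.ofAdd (n * m)) p := by
    induction n with
    | zero => exact ⟨1, one_ne_zero, by simp⟩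
    | succ n ih =>
      obtain ⟨p, hp, h⟩ := ih
      refine ⟨p * Multiplicative.ofAdd (n * m) • q,
        mul_ne_zero hp ((smul_ne_zero_iff_ne _).mpr hq), ?_⟩
      rw [pow_succ, map_mul, h, hz, single_mul_single, ← ofAdd_add]
      congr 2
      push_cast
      ring
  cases k with
  | ofNat n =>
    obtain ⟨p, hp, h⟩ := key SUα 1 1 one_ne_zero toSkewLaurent_α n
    exact ⟨p, hp, by rwa [mul_one] at h⟩
  | negSucc n =>
    obtain ⟨p, hp, h⟩ := key SUαs (-1) normα normα_ne_zero toSkewLaurent_αs (n + 1)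
    refine ⟨p, hp, ?_⟩
    rw [αPow, h]
    congr 2
    push_cast
    rw [Int.negSucc_eq]
    ring

/-- The additive map `∑ k, f k ↦ ∑ k, α ^ k * f k`. -/
noncomputable def sumαPow : (ℤ →₀ Coeff) →+ PolSU :=
  Finsupp.liftAddHom fun k ↦ (AddMonoidHom.mulLeft (αPow k)).comp (ofCoeffs : Coeff →+ PolSU)

theorem sumαPow_single (k : ℤ) (p : Coeff) :
    sumαPow (Finsupp.single k p) = αPow k * ofCoeffs p := by
  simp [sumαPow]

theorem mul_sumαPow_mem_range {z : PolSU}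
    (h : ∀ k, ∃ l q, z * αPow k = αPow l * ofCoeffs q) (f : ℤ →₀ Coeff) :
    z * sumαPow f ∈ AddMonoidHom.mrange sumαPow := by
  induction f using Finsupp.induction_linear with
  | zero => simp
  | add f g hf hg => rw [map_add, mul_add]; exact add_mem hf hg
  | single k p =>
    obtain ⟨l, q, hq⟩ := h k
    refine ⟨Finsupp.single l (q * p), ?_⟩
    rw [sumαPow_single, sumαPow_single, ← mul_assoc, hq, map_mul, mul_assoc]

theorem sumαPow_surjective : Function.Surjective sumαPow := by
  have ofCoeffs_mul (p : Coeff) (f : ℤ →₀ Coeff) :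
      ofCoeffs p * sumαPow f ∈ AddMonoidHom.mrange sumαPow :=
    mul_sumαPow_mem_range (fun k ↦ ⟨k, ofCoeffs_mul_αPow p k⟩) f
  have key (z : PolSU) (f : ℤ →₀ Coeff) : z * sumαPow f ∈ AddMonoidHom.mrange sumαPow := by
    obtain ⟨z, rfl⟩ := RingQuot.mkAlgHom_surjective ℂ SUrel z
    induction z using FreeAlgebra.induction generalizing f with
    | grade0 c => simpa using ofCoeffs_mul (C (C c)) f
    | grade1 x =>
      cases x with
      | a => exact mul_sumαPow_mem_range (fun k ↦ ⟨_, α_mul_αPow k⟩) f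
      | as => exact mul_sumαPow_mem_range (fun k ↦ ⟨_, αs_mul_αPow k⟩) f
      | g =>
        have h := ofCoeffs_mul (C X) f
        rw [ofCoeffs_C_X] at h
        exact h
      | gs =>
        have h := ofCoeffs_mul X f
        rw [ofCoeffs_X] at h
        exact h
    | mul x y hx hy =>
      obtain ⟨g, hg⟩ := hy f
      rw [map_mul, mul_assoc, ← hg]
      exact hx g
    | add x y hx hy => rw [map_add, add_mul]; exact add_mem (hx f) (hy f)
  intro z
  have h := key z (Finsupp.single 0 1)
  rwa [sumαPow_single, map_one, mul_one, show αPow 0 = 1 from pow_zero SUα, mul_one] at h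

theorem toSkewLaurent_injective : Function.Injective toSkewLaurent := by
  rw [injective_iff_map_eq_zero]
  intro x hx
  obtain ⟨f, rfl⟩ := sumαPow_surjective x
  choose p hp hα using toSkewLaurent_αPow
  have coeff_eq (k : ℤ) : (toSkewLaurent (sumαPow f)).coeff (Multiplicative.ofAdd k) =
      p k * Multiplicative.ofAdd k • f k := by
    clear hx
    induction f using Finsupp.induction_linear with
    | zero => simp
    | add f g hf hg => simp [hf, hg, mul_add]
    | single l q =>
      classical
      rw [sumαPow_single, map_mul, hα, toSkewLaurent_ofCoeffs, single_mul_single, mul_one,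
        coeff_single_apply, Finsupp.single_apply]
      by_cases h : l = k
      · subst h; simp
      · simp [h]
  have hf : f = 0 := by
    ext1 k
    have h := coeff_eq k
    rw [hx, SkewMonoidAlgebra.coeff_zero, Finsupp.zero_apply, eq_comm, mul_eq_zero,
      smul_eq_zero_iff_eq] at h
    exact h.resolve_left (hp k)
  rw [hf, map_zero]

end PolSU

/-- The ring `Pol(SU_{-1}(2))` is a domain. -/
theorem polSU_isDomain :
    Nontrivial PolSU ∧ ∀ x y : PolSU, x * y = 0 → x = 0 ∨ y = 0 := by
  have := SkewMonoidAlgebra.noZeroDivisors (k := PolSU.Coeff) (G := Multiplicative ℤ)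
  have := PolSU.toSkewLaurent_injective.noZeroDivisors _ (map_zero _) (map_mul _)
  exact ⟨PolSU.toSkewLaurent.toRingHom.domain_nontrivial,
    fun _ _ ↦ eq_zero_or_eq_zero_of_mul_eq_zero⟩
end

section
/- For all integers i, j ∈ ℤ there exists an element p of the unital subalgebra of Pol(SU_{-1}(2)) generated by γ and γˢ such that α^i · α^j = α^{i+j} · p. -/
/-- The integer power `α^i`: the usual power `α^i` for `i ≥ 0` and `(α*)^(-i)` for `i < 0`. -/
noncomputable def SUαpow (i : ℤ) : PolSU :=
  if 0 ≤ i then SUα ^ i.toNat else SUαs ^ (-i).toNat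

theorem SUγ_mul_SUγs : SUγ * SUγs = SUγs * SUγ := by
  have h := RingQuot.mkAlgHom_rel ℂ SUrel.r3
  simp only [map_sub, map_mul, map_zero] at h
  exact sub_eq_zero.mp h

theorem SUαs_mul_SUα : SUαs * SUα = 1 - SUγs * SUγ := by
  have h := RingQuot.mkAlgHom_rel ℂ SUrel.r1
  simp only [map_sub, map_add, map_mul, map_one, map_zero] at h
  exact eq_sub_of_add_eq (sub_eq_zero.mp h)

theorem SUα_mul_SUαs : SUα * SUαs = 1 - SUγ * SUγs := by
  have h := RingQuot.mkAlgHom_rel ℂ SUrel.r2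
  simp only [map_sub, map_add, map_mul, map_one, map_zero] at h
  exact eq_sub_of_add_eq (sub_eq_zero.mp h)

/-- At parameter `-1` the generator `α` is normal. -/
theorem commute_SUα_SUαs : Commute SUα SUαs := by
  rw [Commute, SemiconjBy, SUα_mul_SUαs, SUαs_mul_SUα, SUγ_mul_SUγs]

theorem SUα_mul_SUαs_mem_adjoin :
    SUα * SUαs ∈ Algebra.adjoin ℂ ({SUγ, SUγs} : Set PolSU) := by
  rw [SUα_mul_SUαs]
  exact sub_mem (one_mem _) (mul_mem (Algebra.subset_adjoin (by simp))
    (Algebra.subset_adjoin (by simp)))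

theorem SUαpow_natCast (n : ℕ) : SUαpow n = SUα ^ n := by
  simp [SUαpow]

theorem SUαpow_neg_natCast (n : ℕ) : SUαpow (-n) = SUαs ^ n := by
  rcases n.eq_zero_or_pos with rfl | hn
  · simp [SUαpow]
  · simp [SUαpow, hn.ne']

theorem SUα_pow_mul_SUαs_pow (m n : ℕ) :
    SUα ^ m * SUαs ^ n = SUαpow (m - n) * (SUα * SUαs) ^ min m n := by
  rw [commute_SUα_SUαs.mul_pow]
  rcases le_total n m with h | h
  · obtain ⟨k, rfl⟩ := Nat.exists_eq_add_of_le' h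
    have hk : ((k + n : ℕ) : ℤ) - n = k := by push_cast; ring
    rw [hk, SUαpow_natCast, min_eq_right h, pow_add, mul_assoc]
  · obtain ⟨k, rfl⟩ := Nat.exists_eq_add_of_le h
    have hk : (m : ℤ) - (m + k : ℕ) = -k := by push_cast; ring
    rw [hk, SUαpow_neg_natCast, min_eq_left h, pow_add, ← mul_assoc,
      ((commute_SUα_SUαs.pow_pow m k).mul_left ((Commute.refl SUαs).pow_pow m k)).eq]

theorem exists_SUαpow_mul_SUαpow (i j : ℤ) :
    ∃ n : ℕ, SUαpow i * SUαpow j = SUαpow (i + j) * (SUα * SUαs) ^ n := by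
  obtain ⟨m, rfl | rfl⟩ := i.eq_nat_or_neg <;> obtain ⟨n, rfl | rfl⟩ := j.eq_nat_or_neg
  · refine ⟨0, ?_⟩
    rw [← Nat.cast_add]
    simp only [SUαpow_natCast, pow_add, pow_zero, mul_one]
  · refine ⟨min m n, ?_⟩
    rw [SUαpow_natCast, SUαpow_neg_natCast, SUα_pow_mul_SUαs_pow, sub_eq_add_neg]
  · refine ⟨min n m, ?_⟩
    rw [SUαpow_natCast, SUαpow_neg_natCast, ← (commute_SUα_SUαs.pow_pow n m).eq,
      SUα_pow_mul_SUαs_pow, neg_add_eq_sub]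
  · refine ⟨0, ?_⟩
    rw [← neg_add, ← Nat.cast_add]
    simp only [SUαpow_neg_natCast, pow_add, pow_zero, mul_one]

/-- For all integers `i, j` there is an element `p` of the unital subalgebra generated by
`γ` and `γ*` such that `α^i * α^j = α^(i+j) * p`. -/
theorem polSU_apow_mul_apow (i j : ℤ) :
    ∃ p ∈ Algebra.adjoin ℂ ({SUγ, SUγs} : Set PolSU),
      SUαpow i * SUαpow j = SUαpow (i + j) * p := by
  obtain ⟨n, hn⟩ := exists_SUαpow_mul_SUαpow i j
  exact ⟨_, pow_mem SUα_mul_SUαs_mem_adjoin n, hn⟩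
end

section
/- Suppose n ≥ 1 and u_{ij} ∈ B (1 ≤ i,j ≤ n) satisfy ∑_{k=1}^n (u_{ki})*·u_{kj} = δ_{ij}·1, ∑_{k=1}^n u_{ik}·(u_{jk})* = δ_{ij}·1 and ε(u_{ij}) = δ_{ij} for all i, j, and that B is generated as a unital ℂ-algebra by the set {u_{ij} : 1 ≤ i,j ≤ n} ∪ {(u_{ij})* : 1 ≤ i,j ≤ n}. If a 1-cocycle c : B → X satisfies c(u_{ij}) = 0 for all i, j, then c = 0. -/
/-- Let `B` be a unital `*`-algebra over `ℂ` generated by the entries of a matrix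
`u` and their adjoints, where `u` and `ū` are unitary (`∑ k, (u k i)* (u k j) = δ_{ij} 1`,
`∑ k, u i k * (u j k)* = δ_{ij} 1`) and `ε (u i j) = δ_{ij}` for a unital algebra
homomorphism `ε : B → ℂ`.  If a 1-cocycle `c : B → X` into a left `B`-module `X`
vanishes on all `u i j`, then `c = 0`. -/
theorem cocycle_determined_by_generators
    (B : Type*) [Ring B] [Algebra ℂ B] [StarRing B] [StarModule ℂ B]
    (ε : B →ₐ[ℂ] ℂ)
    (X : Type*) [AddCommGroup X] [Module ℂ X] [Module B X] [IsScalarTower ℂ B X]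
    (n : ℕ) (hn : 1 ≤ n) (u : Fin n → Fin n → B)
    (hcol : ∀ i j, ∑ k, star (u k i) * u k j = if i = j then (1 : B) else 0)
    (hrow : ∀ i j, ∑ k, u i k * star (u j k) = if i = j then (1 : B) else 0)
    (hε : ∀ i j, ε (u i j) = if i = j then (1 : ℂ) else 0)
    (hgen : Algebra.adjoin ℂ {x : B | ∃ i j, x = u i j ∨ x = star (u i j)} = ⊤)
    (c : B →ₗ[ℂ] X)
    (hc : ∀ a b : B, c (a * b) = a • c b + ε b • c a)
    (hc0 : ∀ i j, c (u i j) = 0) :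
    c = 0 := by
  have h1 : c 1 = 0 := by simpa using hc 1 1
  have hstar (i j : Fin n) : c (star (u j i)) = 0 := by
    have h := congrArg c (hcol i j)
    simpa [hc, hc0, hε, ite_smul, apply_ite c, h1] using h
  ext b
  have hb : b ∈ Algebra.adjoin ℂ {x : B | ∃ i j, x = u i j ∨ x = star (u i j)} :=
    hgen ▸ Algebra.mem_top
  induction hb using Algebra.adjoin_induction with
  | mem x hx =>
    obtain ⟨i, j, rfl | rfl⟩ := hx
    · exact hc0 i j
    · exact hstar j i
  | algebraMap r => simp [Algebra.algebraMap_eq_smul_one, h1]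
  | add x y _ _ hx hy => simp_all
  | mul x y _ _ hx hy => simp_all
end

section
/- Suppose n ≥ 1 and u_{ij} ∈ B (1 ≤ i,j ≤ n) satisfy ∑_{k=1}^n (u_{ki})*·u_{kj} = δ_{ij}·1, ∑_{k=1}^n u_{ik}·(u_{jk})* = δ_{ij}·1 and ε(u_{ij}) = δ_{ij} for all i, j, and that B is generated as a unital ℂ-algebra by the set {u_{ij} : 1 ≤ i,j ≤ n} ∪ {(u_{ij})* : 1 ≤ i,j ≤ n}. If a 1-cocycle c : B → X satisfies c((u_{ij})*) = 0 for all i, j, then c = 0. -/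
/-- Let `B` be a unital `*`-algebra over `ℂ` generated by the entries of a matrix
`u` and their adjoints, where `u` and `ū` are unitary (`∑ k, (u k i)* (u k j) = δ_{ij} 1`,
`∑ k, u i k * (u j k)* = δ_{ij} 1`) and `ε (u i j) = δ_{ij}` for a unital algebra
homomorphism `ε : B → ℂ`.  If a 1-cocycle `c : B → X` into a left `B`-module `X`
vanishes on all `(u i j)*`, then `c = 0`. -/
theorem cocycle_determined_by_star_generators
    (B : Type*) [Ring B] [Algebra ℂ B] [StarRing B] [StarModule ℂ B]
    (ε : B →ₐ[ℂ] ℂ)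
    (X : Type*) [AddCommGroup X] [Module ℂ X] [Module B X] [IsScalarTower ℂ B X]
    (n : ℕ) (hn : 1 ≤ n) (u : Fin n → Fin n → B)
    (hcol : ∀ i j, ∑ k, star (u k i) * u k j = if i = j then (1 : B) else 0)
    (hrow : ∀ i j, ∑ k, u i k * star (u j k) = if i = j then (1 : B) else 0)
    (hε : ∀ i j, ε (u i j) = if i = j then (1 : ℂ) else 0)
    (hgen : Algebra.adjoin ℂ {x : B | ∃ i j, x = u i j ∨ x = star (u i j)} = ⊤)
    (c : B →ₗ[ℂ] X)
    (hc : ∀ a b : B, c (a * b) = a • c b + ε b • c a)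
    (hc0 : ∀ i j, c (star (u i j)) = 0) :
    c = 0 := by
  have c_one : c 1 = 0 := by simpa using hc 1 1
  have star_sum (i j : Fin n) : ∑ k, star (u k i) • c (u k j) = 0 := by
    have h := congrArg c (hcol i j)
    simp only [map_sum, hc, hc0, smul_zero, add_zero] at h
    rw [h]
    split_ifs <;> simp [c_one]
  have c_u (l j : Fin n) : c (u l j) = 0 := by
    calc c (u l j) = ∑ k, (∑ i, u l i * star (u k i)) • c (u k j) := by
          simp [hrow, ite_smul]
      _ = ∑ i, u l i • ∑ k, star (u k i) • c (u k j) := by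
          simp only [Finset.sum_smul, Finset.smul_sum, mul_smul]
          exact Finset.sum_comm
      _ = 0 := by simp [star_sum]
  ext b
  have hb : b ∈ Algebra.adjoin ℂ {x : B | ∃ i j, x = u i j ∨ x = star (u i j)} :=
    hgen ▸ Algebra.mem_top
  induction hb using Algebra.adjoin_induction with
  | mem x hx =>
    obtain ⟨i, j, rfl | rfl⟩ := hx
    · exact c_u i j
    · exact hc0 i j
  | algebraMap r => simp [Algebra.algebraMap_eq_smul_one, c_one]
  | add x y _ _ hx hy => simp_all
  | mul x y _ _ hx hy => simp_all
end

section
/- Let U denote the unital subalgebra of Pol(ℍ_n) generated by the elements {z·v_{ij} : 1 ≤ i,j ≤ n} ∪ {v_{ij}·z' : 1 ≤ i,j ≤ n} (a copy of Pol(U_n⁺) inside Pol(ℍ_n)). Let X be a left Pol(ℍ_n)-module and let c : U → X be a ℂ-linear map satisfying c(ab) = a·c(b) + ε(b)·c(a) for all a, b ∈ U. If there exists ξ ∈ X such that c(z·v_{ij}) = δ_{ij}·ξ for all i, j, then there exists a 1-cocycle c̃ : Pol(ℍ_n) → X with values in X whose restriction to U equals c. -/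
/-- Generators of `Pol(ℍ_n)`: `z`, `z'` (representing `z` and `z* = z⁻¹`) and the `v i j`. -/
inductive Hgen (n : ℕ) : Type
  | z : Hgen n
  | z' : Hgen n
  | v : Fin n → Fin n → Hgen n

open FreeAlgebra Hgen in
/-- The defining relations of `Pol(ℍ_n) = Pol(O_n⁺) ∗ ℂ[ℤ]`. -/
inductive Hrel (n : ℕ) : FreeAlgebra ℂ (Hgen n) → FreeAlgebra ℂ (Hgen n) → Prop
  | zz' : Hrel n (ι ℂ (z : Hgen n) * ι ℂ (z' : Hgen n)) 1
  | z'z : Hrel n (ι ℂ (z' : Hgen n) * ι ℂ (z : Hgen n)) 1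
  | col (i j : Fin n) :
      Hrel n (∑ k, ι ℂ (v k i : Hgen n) * ι ℂ (v k j : Hgen n)) (if i = j then 1 else 0)
  | row (i j : Fin n) :
      Hrel n (∑ k, ι ℂ (v i k : Hgen n) * ι ℂ (v j k : Hgen n)) (if i = j then 1 else 0)

/-- `Pol(ℍ_n)`: the universal unital `ℂ`-algebra on `z, z', v i j` with the above relations. -/
noncomputable abbrev PolH (n : ℕ) : Type := RingQuot (Hrel n)

/-- The generator `z` of `Pol(ℍ_n)`. -/
noncomputable def zH (n : ℕ) : PolH n := RingQuot.mkAlgHom ℂ (Hrel n) (FreeAlgebra.ι ℂ Hgen.z)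

/-- The generator `z' = z*` of `Pol(ℍ_n)`. -/
noncomputable def z'H (n : ℕ) : PolH n := RingQuot.mkAlgHom ℂ (Hrel n) (FreeAlgebra.ι ℂ Hgen.z')

/-- The generators `v i j` of `Pol(ℍ_n)`. -/
noncomputable def vH (n : ℕ) (i j : Fin n) : PolH n :=
  RingQuot.mkAlgHom ℂ (Hrel n) (FreeAlgebra.ι ℂ (Hgen.v i j))

/-- The copy of `Pol(U_n⁺)` inside `Pol(ℍ_n)`: the unital subalgebra generated by the
elements `z * v i j` and `v i j * z'`. -/
noncomputable def UH (n : ℕ) : Subalgebra ℂ (PolH n) :=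
  Algebra.adjoin ℂ {x : PolH n | ∃ i j, x = zH n * vH n i j ∨ x = vH n i j * z'H n}

theorem zvH_mem_UH (n : ℕ) (i j : Fin n) : zH n * vH n i j ∈ UH n :=
  Algebra.subset_adjoin ⟨i, j, Or.inl rfl⟩

/-- The affine endomorphism `(x, l) ↦ (a • x + l • η, χ * l)` of `X × ℂ`. Multiplicative families
of these encode 1-cocycles with values in `X`. -/
noncomputable def affineEnd {A X : Type*} [Ring A] [Algebra ℂ A] [AddCommGroup X] [Module ℂ X]
    [Module A X] [IsScalarTower ℂ A X] (a : A) (η : X) (χ : ℂ) : Module.End ℂ (X × ℂ) :=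
  ((Algebra.lsmul ℂ ℂ X a).coprod (LinearMap.toSpanSingleton ℂ X η)).prod
    (χ • LinearMap.snd ℂ X ℂ)

section AffineEnd

variable {A X : Type*} [Ring A] [Algebra ℂ A] [AddCommGroup X] [Module ℂ X]
  [Module A X] [IsScalarTower ℂ A X]

@[simp]
theorem affineEnd_apply (a : A) (η : X) (χ : ℂ) (p : X × ℂ) :
    affineEnd a η χ p = (a • p.1 + p.2 • η, χ * p.2) := by
  simp [affineEnd]

theorem affineEnd_mul (a b : A) (η θ : X) (χ ψ : ℂ) :
    affineEnd a η χ * affineEnd b θ ψ = affineEnd (a * b) (a • θ + ψ • η) (χ * ψ) := by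
  refine LinearMap.ext fun p => Prod.ext ?_ ?_
  · simp only [Module.End.mul_apply, affineEnd_apply, smul_add, mul_smul, smul_comm a p.2 θ,
      smul_comm p.2 ψ η]
    abel
  · simp [mul_assoc]

theorem affineEnd_add (a b : A) (η θ : X) (χ ψ : ℂ) :
    affineEnd a η χ + affineEnd b θ ψ = affineEnd (a + b) (η + θ) (χ + ψ) := by
  refine LinearMap.ext fun p => Prod.ext ?_ ?_
  · simp only [LinearMap.add_apply, affineEnd_apply, Prod.fst_add, add_smul, smul_add]
    abel
  · simp [add_mul]

theorem affineEnd_zero : affineEnd (0 : A) (0 : X) 0 = 0 :=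
  LinearMap.ext fun p => by simp

theorem affineEnd_algebraMap (r : ℂ) :
    affineEnd (algebraMap ℂ A r) (0 : X) r = algebraMap ℂ (Module.End ℂ (X × ℂ)) r :=
  LinearMap.ext fun p => Prod.ext (by simp [Module.algebraMap_end_apply])
    (by simp [Module.algebraMap_end_apply])

theorem affineEnd_one : affineEnd (1 : A) (0 : X) 1 = 1 :=
  LinearMap.ext fun p => by simp

theorem affineEnd_ite (P : Prop) [Decidable P] :
    affineEnd (if P then 1 else 0 : A) (0 : X) (if P then 1 else 0) = if P then 1 else 0 := by
  split_ifs
  · exact affineEnd_one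
  · exact affineEnd_zero

theorem sum_affineEnd {ι : Type*} (s : Finset ι) (a : ι → A) (χ : ι → ℂ) :
    ∑ k ∈ s, affineEnd (a k) (0 : X) (χ k) = affineEnd (∑ k ∈ s, a k) 0 (∑ k ∈ s, χ k) := by
  classical
  induction s using Finset.induction_on with
  | empty => simp [affineEnd_zero]
  | insert i s hi ih => simp [Finset.sum_insert hi, ih, affineEnd_add]

end AffineEnd

section PolH

variable {n : ℕ}

theorem zH_mul_z'H : zH n * z'H n = 1 := by
  simpa [zH, z'H] using RingQuot.mkAlgHom_rel ℂ (Hrel.zz' (n := n))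

theorem z'H_mul_zH : z'H n * zH n = 1 := by
  simpa [zH, z'H] using RingQuot.mkAlgHom_rel ℂ (Hrel.z'z (n := n))

theorem sum_vH_col (i j : Fin n) : ∑ k, vH n k i * vH n k j = if i = j then 1 else 0 := by
  have h := RingQuot.mkAlgHom_rel ℂ (Hrel.col i j)
  rw [apply_ite (RingQuot.mkAlgHom ℂ (Hrel n))] at h
  simpa [vH] using h

theorem sum_vH_row (i j : Fin n) : ∑ k, vH n i k * vH n j k = if i = j then 1 else 0 := by
  have h := RingQuot.mkAlgHom_rel ℂ (Hrel.row i j)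
  rw [apply_ite (RingQuot.mkAlgHom ℂ (Hrel n))] at h
  simpa [vH] using h

/-- An induction principle for `Pol(ℍ_n)` along its generators. -/
theorem PolH.induction {p : PolH n → Prop} (hz : p (zH n)) (hz' : p (z'H n))
    (hv : ∀ i j, p (vH n i j)) (hr : ∀ r : ℂ, p (algebraMap ℂ (PolH n) r))
    (hmul : ∀ a b, p a → p b → p (a * b)) (hadd : ∀ a b, p a → p b → p (a + b))
    (a : PolH n) : p a := by
  obtain ⟨a, rfl⟩ := RingQuot.mkAlgHom_surjective ℂ (Hrel n) a
  induction a using FreeAlgebra.induction with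
  | grade0 r => simpa using hr r
  | grade1 g =>
    cases g with
    | z => exact hz
    | z' => exact hz'
    | v i j => exact hv i j
  | mul a b ha hb => simpa using hmul _ _ ha hb
  | add a b ha hb => simpa using hadd _ _ ha hb

variable {X : Type*} [AddCommGroup X] [Module ℂ X] [Module (PolH n) X]

theorem vz'H_mem_UH (i j : Fin n) : vH n i j * z'H n ∈ UH n :=
  Algebra.subset_adjoin ⟨i, j, Or.inr rfl⟩

/-- The values of a cocycle on the elements `v i j * z'` are forced by those on `z * v i j`. -/
theorem cocycle_vz'H (ε : PolH n →ₐ[ℂ] ℂ) (hεz : ε (zH n) = 1)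
    (hεv : ∀ i j, ε (vH n i j) = if i = j then (1 : ℂ) else 0)
    (c : UH n →ₗ[ℂ] X)
    (hc : ∀ a b : UH n, c (a * b) = (a : PolH n) • c b + ε (b : PolH n) • c a) (ξ : X)
    (hξ : ∀ i j, c ⟨zH n * vH n i j, zvH_mem_UH n i j⟩ = (if i = j then (1 : ℂ) else 0) • ξ)
    (i j : Fin n) :
    c ⟨vH n i j * z'H n, vz'H_mem_UH i j⟩ = -((vH n i j * z'H n) • ξ) := by
  have hone : c 1 = 0 := by simpa using hc 1 1
  have hsum : ∑ k, (⟨vH n k j * z'H n, vz'H_mem_UH k j⟩ : UH n) *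
      ⟨zH n * vH n k i, zvH_mem_UH n k i⟩ = if j = i then 1 else 0 := by
    apply Subtype.ext
    have h (k : Fin n) : vH n k j * z'H n * (zH n * vH n k i) = vH n k j * vH n k i := by
      rw [mul_assoc, ← mul_assoc (z'H n), z'H_mul_zH, one_mul]
    rw [apply_ite (Subtype.val : UH n → PolH n)]
    simpa [h] using sum_vH_col j i
  have h := congrArg c hsum
  rw [apply_ite c, hone, map_zero, ite_self, map_sum] at h
  simp only [hc, hξ, map_mul, hεz, hεv, one_mul, ite_smul, one_smul, zero_smul, smul_ite,
    smul_zero, Finset.sum_add_distrib, Finset.sum_ite_eq', Finset.mem_univ, if_true] at h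
  exact eq_neg_of_add_eq_zero_right h

variable [IsScalarTower ℂ (PolH n) X]

/-- The images of the generators under the representation on `X × ℂ` encoding the cocycle with
`z ↦ ξ` and `v i j ↦ 0`. -/
noncomputable def genEnd (ξ : X) : Hgen n → Module.End ℂ (X × ℂ)
  | .z => affineEnd (zH n) ξ 1
  | .z' => affineEnd (z'H n) (-(z'H n • ξ)) 1
  | .v i j => affineEnd (vH n i j) 0 (if i = j then 1 else 0)

theorem genEnd_rel (ξ : X) ⦃a b : FreeAlgebra ℂ (Hgen n)⦄ (h : Hrel n a b) :
    FreeAlgebra.lift ℂ (genEnd ξ) a = FreeAlgebra.lift ℂ (genEnd ξ) b := by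
  cases h with
  | zz' => simp [genEnd, affineEnd_mul, zH_mul_z'H, smul_smul, affineEnd_one]
  | z'z => simp [genEnd, affineEnd_mul, z'H_mul_zH, affineEnd_one]
  | col i j =>
    rw [apply_ite (FreeAlgebra.lift ℂ (genEnd ξ)), map_one, map_zero,
      ← affineEnd_ite (A := PolH n), ← sum_vH_col]
    simp [genEnd, affineEnd_mul, sum_affineEnd, eq_comm]
  | row i j =>
    rw [apply_ite (FreeAlgebra.lift ℂ (genEnd ξ)), map_one, map_zero,
      ← affineEnd_ite (A := PolH n), ← sum_vH_row]
    simp [genEnd, affineEnd_mul, sum_affineEnd]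

/-- For every `ξ` there is a 1-cocycle on `Pol(ℍ_n)` with `z ↦ ξ` and `v i j ↦ 0`. -/
theorem exists_cocycle (ε : PolH n →ₐ[ℂ] ℂ) (hεz : ε (zH n) = 1) (hεz' : ε (z'H n) = 1)
    (hεv : ∀ i j, ε (vH n i j) = if i = j then (1 : ℂ) else 0) (ξ : X) :
    ∃ d : PolH n →ₗ[ℂ] X, (∀ a b : PolH n, d (a * b) = a • d b + ε b • d a) ∧
      d (zH n) = ξ ∧ d (z'H n) = -(z'H n • ξ) ∧ ∀ i j, d (vH n i j) = 0 := by
  let ρ : PolH n →ₐ[ℂ] Module.End ℂ (X × ℂ) :=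
    RingQuot.liftAlgHom ℂ ⟨FreeAlgebra.lift ℂ (genEnd ξ), genEnd_rel ξ⟩
  have hρz : ρ (zH n) = affineEnd (zH n) ξ 1 := by simp [ρ, zH, genEnd]
  have hρz' : ρ (z'H n) = affineEnd (z'H n) (-(z'H n • ξ)) 1 := by simp [ρ, z'H, genEnd]
  have hρv (i j) : ρ (vH n i j) = affineEnd (vH n i j) 0 (if i = j then 1 else 0) := by
    simp [ρ, vH, genEnd]
  have key (a : PolH n) : ∃ η : X, ρ a = affineEnd a η (ε a) := by
    induction a using PolH.induction with
    | hz => exact ⟨ξ, by rw [hρz, hεz]⟩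
    | hz' => exact ⟨_, by rw [hρz', hεz']⟩
    | hv i j => exact ⟨0, by rw [hρv, hεv]⟩
    | hr r =>
      refine ⟨0, ?_⟩
      rw [AlgHom.commutes, AlgHom.commutes]
      exact (affineEnd_algebraMap r).symm
    | hmul a b ha hb =>
      obtain ⟨η, hη⟩ := ha
      obtain ⟨θ, hθ⟩ := hb
      exact ⟨_, by rw [map_mul, hη, hθ, affineEnd_mul, map_mul]⟩
    | hadd a b ha hb =>
      obtain ⟨η, hη⟩ := ha
      obtain ⟨θ, hθ⟩ := hb
      exact ⟨_, by rw [map_add, hη, hθ, affineEnd_add, map_add]⟩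
  let d : PolH n →ₗ[ℂ] X :=
    LinearMap.fst ℂ X ℂ ∘ₗ LinearMap.applyₗ ((0, 1) : X × ℂ) ∘ₗ ρ.toLinearMap
  have hd {a : PolH n} {η : X} {χ : ℂ} (h : ρ a = affineEnd a η χ) : d a = η := by
    simp [d, h]
  refine ⟨d, fun a b => ?_, hd hρz, hd hρz', fun i j => hd (hρv i j)⟩
  obtain ⟨η, hη⟩ := key a
  obtain ⟨θ, hθ⟩ := key b
  rw [hd hη, hd hθ]
  exact hd (by rw [map_mul, hη, hθ, affineEnd_mul])

end PolH

/-- If a 1-cocycle `c` on the copy `U ≅ Pol(U_n⁺)` of inside `Pol(ℍ_n)` (with values in a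
left `Pol(ℍ_n)`-module `X`) satisfies `c (z * v i j) = δ_{ij} • ξ` for some `ξ ∈ X`, then
`c` extends to a 1-cocycle on all of `Pol(ℍ_n)`. -/
theorem polH_cocycle_extension
    (n : ℕ) (hn : 2 ≤ n)
    (ε : PolH n →ₐ[ℂ] ℂ) (hεz : ε (zH n) = 1) (hεz' : ε (z'H n) = 1)
    (hεv : ∀ i j, ε (vH n i j) = if i = j then (1 : ℂ) else 0)
    (X : Type*) [AddCommGroup X] [Module ℂ X] [Module (PolH n) X]
    [IsScalarTower ℂ (PolH n) X]
    (c : UH n →ₗ[ℂ] X)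
    (hc : ∀ a b : UH n, c (a * b) = (a : PolH n) • c b + ε (b : PolH n) • c a)
    (ξ : X)
    (hξ : ∀ i j, c ⟨zH n * vH n i j, zvH_mem_UH n i j⟩ = (if i = j then (1 : ℂ) else 0) • ξ) :
    ∃ ct : PolH n →ₗ[ℂ] X,
      (∀ a b : PolH n, ct (a * b) = a • ct b + ε b • ct a) ∧
      ∀ a : UH n, ct (a : PolH n) = c a := by
  obtain ⟨d, hd, hdz, hdz', hdv⟩ := exists_cocycle ε hεz hεz' hεv ξ
  refine ⟨d, hd, ?_⟩
  rintro ⟨a, ha⟩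
  change d a = c ⟨a, ha⟩
  have hone : c 1 = 0 := by simpa using hc 1 1
  have hdone : d 1 = 0 := by simpa using hd 1 1
  induction ha using Algebra.adjoin_induction with
  | mem x hx =>
    obtain ⟨i, j, rfl | rfl⟩ := hx
    · rw [hd, hdz, hdv, hεv, smul_zero, zero_add]
      exact (hξ i j).symm
    · rw [hd, hdz', hdv, smul_zero, add_zero, smul_neg, smul_smul]
      exact (cocycle_vz'H ε hεz hεv c hc ξ hξ i j).symm
  | algebraMap r =>
    change d (algebraMap ℂ (PolH n) r) = c (algebraMap ℂ (UH n) r)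
    rw [Algebra.algebraMap_eq_smul_one, Algebra.algebraMap_eq_smul_one, map_smul, map_smul,
      hone, hdone, smul_zero]
  | add x y hx hy ihx ihy =>
    rw [map_add, ihx, ihy, ← map_add]
    rfl
  | mul x y hx hy ihx ihy =>
    rw [hd, ihx, ihy]
    exact (hc ⟨x, hx⟩ ⟨y, hy⟩).symm
end

section
/- Let X be a left Pol(U_n⁺)-module and let c be a 1-cocycle with values in X such that c(u'_{ij}·u_{kl}) = 0 for all 1 ≤ i,j,k,l ≤ n (so that c vanishes on the subalgebra Pol(𝔸_n) of Pol(U_n⁺) generated by these elements). Then c(u_{ij}) = δ_{ij}·c(u_{11}) for all i, j. -/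
/-- Generators of `Pol(U_n⁺)`: `u i j` and `u' i j` (the latter representing `(u i j)*`). -/
inductive Ugen (n : ℕ) : Type
  | u : Fin n → Fin n → Ugen n
  | u' : Fin n → Fin n → Ugen n

open FreeAlgebra Ugen in
/-- The defining relations of `Pol(U_n⁺)`: the matrices `u` and `ū` are unitary. -/
inductive Urel (n : ℕ) : FreeAlgebra ℂ (Ugen n) → FreeAlgebra ℂ (Ugen n) → Prop
  | r1 (i j : Fin n) :
      Urel n (∑ k, ι ℂ (u' k i : Ugen n) * ι ℂ (u k j : Ugen n)) (if i = j then 1 else 0)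
  | r2 (i j : Fin n) :
      Urel n (∑ k, ι ℂ (u i k : Ugen n) * ι ℂ (u' j k : Ugen n)) (if i = j then 1 else 0)
  | r3 (i j : Fin n) :
      Urel n (∑ k, ι ℂ (u k i : Ugen n) * ι ℂ (u' k j : Ugen n)) (if i = j then 1 else 0)
  | r4 (i j : Fin n) :
      Urel n (∑ k, ι ℂ (u' i k : Ugen n) * ι ℂ (u j k : Ugen n)) (if i = j then 1 else 0)

/-- `Pol(U_n⁺)`: the universal unital `ℂ`-algebra on `u i j`, `u' i j` with the above
relations. -/
noncomputable abbrev PolU (n : ℕ) : Type := RingQuot (Urel n)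

/-- The generators `u i j` of `Pol(U_n⁺)`. -/
noncomputable def uU (n : ℕ) (i j : Fin n) : PolU n :=
  RingQuot.mkAlgHom ℂ (Urel n) (FreeAlgebra.ι ℂ (Ugen.u i j))

/-- The generators `u' i j = (u i j)*` of `Pol(U_n⁺)`. -/
noncomputable def u'U (n : ℕ) (i j : Fin n) : PolU n :=
  RingQuot.mkAlgHom ℂ (Urel n) (FreeAlgebra.ι ℂ (Ugen.u' i j))

/-- The relation `u u* = 1` in `Pol(U_n⁺)`, entrywise. -/
theorem sum_uU_mul_u'U (n : ℕ) (i j : Fin n) :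
    ∑ k, uU n i k * u'U n j k = if i = j then 1 else 0 := by
  have h := RingQuot.mkAlgHom_rel ℂ (Urel.r2 i j)
  rw [map_sum, apply_ite (RingQuot.mkAlgHom ℂ (Urel n)), map_one, map_zero] at h
  simpa only [map_mul, uU, u'U] using h

/-- Elements of a left `Pol(U_n⁺)`-module are separated by the action of the `u' i j`. -/
theorem eq_of_u'U_smul_eq {n : ℕ} {X : Type*} [AddCommGroup X] [Module (PolU n) X]
    (i : Fin n) {x y : X} (h : ∀ j, u'U n i j • x = u'U n i j • y) : x = y := by
  have hone : ∑ k, uU n i k * u'U n i k = 1 := by simpa using sum_uU_mul_u'U n i i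
  rw [← one_smul (PolU n) x, ← one_smul (PolU n) y, ← hone, Finset.sum_smul, Finset.sum_smul]
  exact Finset.sum_congr rfl fun k _ => by rw [mul_smul, mul_smul, h k]

/-- If a 1-cocycle `c` on `Pol(U_n⁺)` (with values in a left `Pol(U_n⁺)`-module `X`, relative
to the counit `ε`) vanishes on all products `(u i j)* (u k l)` (hence on the subalgebra
`Pol(𝔸_n)` generated by these), then `c (u i j) = δ_{ij} • c (u 1 1)`. -/
theorem polU_cocycle_scalar_on_u
    (n : ℕ) (hn : 2 ≤ n)
    (ε : PolU n →ₐ[ℂ] ℂ)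
    (hεu : ∀ i j, ε (uU n i j) = if i = j then (1 : ℂ) else 0)
    (hεu' : ∀ i j, ε (u'U n i j) = if i = j then (1 : ℂ) else 0)
    (X : Type*) [AddCommGroup X] [Module ℂ X] [Module (PolU n) X]
    [IsScalarTower ℂ (PolU n) X]
    (c : PolU n →ₗ[ℂ] X)
    (hc : ∀ a b : PolU n, c (a * b) = a • c b + ε b • c a)
    (hc0 : ∀ i j k l, c (u'U n i j * uU n k l) = 0) :
    ∀ i j, c (uU n i j) =
      (if i = j then (1 : ℂ) else 0) • c (uU n ⟨0, by omega⟩ ⟨0, by omega⟩) := by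
  have key : ∀ i j k l, u'U n i j • c (uU n k l) =
      -((if k = l then (1 : ℂ) else 0) • c (u'U n i j)) := fun i j k l => by
    rw [eq_neg_iff_add_eq_zero, ← hεu, ← hc, hc0]
  intro i j
  refine eq_of_u'U_smul_eq i fun m => ?_
  by_cases hij : i = j
  · rw [if_pos hij, one_smul, key, key, if_pos hij, if_pos rfl]
  · rw [if_neg hij, zero_smul, key, if_neg hij, zero_smul, neg_zero, smul_zero]
end

section
/- The quotient left Pol(O_n⁺)-module Pol(O_n⁺)/I is spanned as a ℂ-vector space by the images of 1 and v_{11}; in particular, the image of v_{ij} in Pol(O_n⁺)/I is 0 whenever i ≠ j, and the images of v_{ii} and v_{jj} coincide for all i, j. -/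
/-- Generators of `Pol(O_n⁺)`. -/
inductive Ogen (n : ℕ) : Type
  | v : Fin n → Fin n → Ogen n

open FreeAlgebra Ogen in
/-- The defining relations of `Pol(O_n⁺)`: `∑ k, v k i * v k j = δ_{ij}` and
`∑ k, v i k * v j k = δ_{ij}`. -/
inductive Orel (n : ℕ) : FreeAlgebra ℂ (Ogen n) → FreeAlgebra ℂ (Ogen n) → Prop
  | col (i j : Fin n) :
      Orel n (∑ k, ι ℂ (v k i : Ogen n) * ι ℂ (v k j : Ogen n)) (if i = j then 1 else 0)
  | row (i j : Fin n) :
      Orel n (∑ k, ι ℂ (v i k : Ogen n) * ι ℂ (v j k : Ogen n)) (if i = j then 1 else 0)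

/-- `Pol(O_n⁺)`: the universal unital `ℂ`-algebra with `n²` generators `v i j` subject to the
above relations. -/
noncomputable abbrev PolO (n : ℕ) : Type := RingQuot (Orel n)

/-- The generators `v i j` of `Pol(O_n⁺)`. -/
noncomputable def vO (n : ℕ) (i j : Fin n) : PolO n :=
  RingQuot.mkAlgHom ℂ (Orel n) (FreeAlgebra.ι ℂ (Ogen.v i j))

/-- The left ideal `I` of `Pol(O_n⁺)` generated by the elements
`v i j * v k l - δ_{ij} δ_{kl} 1`, so that `Pol(O_n⁺)/I` realizes
`Pol(O_n⁺) ⊗_{Pol(𝔸_n)} ℂ`. -/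
noncomputable def IdealO (n : ℕ) : Submodule (PolO n) (PolO n) :=
  Submodule.span (PolO n)
    {x : PolO n | ∃ i j k l, x = vO n i j * vO n k l - if i = j ∧ k = l then 1 else 0}

theorem sum_vO_col_mul (n : ℕ) (i j : Fin n) :
    ∑ k, vO n k i * vO n k j = if i = j then 1 else 0 := by
  have h := RingQuot.mkAlgHom_rel ℂ (Orel.col i j)
  rw [map_sum] at h
  simp only [map_mul] at h
  refine h.trans ?_
  split_ifs <;> simp

theorem vO_mul_vO_sub_mem_IdealO (n : ℕ) (i j k l : Fin n) :
    vO n i j * vO n k l - (if i = j ∧ k = l then 1 else 0) ∈ IdealO n :=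
  Submodule.subset_span ⟨i, j, k, l, rfl⟩

theorem vO_smul_mk_vO (n : ℕ) (i j k l : Fin n) :
    vO n i j • (Submodule.Quotient.mk (vO n k l) : PolO n ⧸ IdealO n) =
      Submodule.Quotient.mk (if i = j ∧ k = l then 1 else 0) := by
  rw [← Submodule.Quotient.mk_smul, smul_eq_mul, Submodule.Quotient.eq]
  exact vO_mul_vO_sub_mem_IdealO n i j k l

/-- Evaluating `∑ k, v k a * v k a * v i j` in the quotient in two ways. -/
theorem mk_vO_eq (n : ℕ) (a i j : Fin n) :
    (Submodule.Quotient.mk (vO n i j) : PolO n ⧸ IdealO n) =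
      if i = j then Submodule.Quotient.mk (vO n a a) else 0 := by
  calc (Submodule.Quotient.mk (vO n i j) : PolO n ⧸ IdealO n)
      = (∑ k, vO n k a * vO n k a) • Submodule.Quotient.mk (vO n i j) := by
        rw [sum_vO_col_mul, if_pos rfl, one_smul]
    _ = ∑ k, vO n k a • Submodule.Quotient.mk (if k = a ∧ i = j then 1 else 0) := by
        rw [Finset.sum_smul]
        exact Finset.sum_congr rfl fun k _ => by rw [mul_smul, vO_smul_mk_vO]
    _ = if i = j then Submodule.Quotient.mk (vO n a a) else 0 := by
        rw [Finset.sum_eq_single a]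
        · by_cases h : i = j
          · simp only [h, and_self, if_true]
            rw [← Submodule.Quotient.mk_smul, smul_eq_mul, mul_one]
          · simp [h]
        · intro k _ hk
          simp [hk]
        · simp

/-- A `ℂ`-subspace of a `Pol(O_n⁺)`-module that is stable under the generators is stable under
`Pol(O_n⁺)`. -/
theorem PolO.smul_mem_of_vO_smul_mem {n : ℕ} {M : Type*} [AddCommGroup M] [Module ℂ M]
    [Module (PolO n) M] [IsScalarTower ℂ (PolO n) M] (S : Submodule ℂ M)
    (hS : ∀ i j, ∀ s ∈ S, vO n i j • s ∈ S) (a : PolO n) {s : M} (hs : s ∈ S) :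
    a • s ∈ S := by
  obtain ⟨x, rfl⟩ := RingQuot.mkAlgHom_surjective ℂ (Orel n) a
  induction x using FreeAlgebra.induction generalizing s with
  | grade0 r =>
    rw [AlgHom.commutes, algebraMap_smul]
    exact S.smul_mem r hs
  | grade1 x =>
    cases x with
    | v i j => exact hS i j s hs
  | mul x y hx hy =>
    rw [map_mul, mul_smul]
    exact hx (hy hs)
  | add x y hx hy =>
    rw [map_add, add_smul]
    exact S.add_mem (hx hs) (hy hs)

/-- The quotient left module `Pol(O_n⁺)/I` is spanned over `ℂ` by the images of `1` and
`v 1 1`; in particular the image of `v i j` vanishes for `i ≠ j` and the images of the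
`v i i` all coincide. -/
theorem polO_quotient_spanned
    (n : ℕ) (hn : 2 ≤ n) :
    Submodule.span ℂ
        ({Submodule.Quotient.mk (1 : PolO n),
          Submodule.Quotient.mk (vO n ⟨0, by omega⟩ ⟨0, by omega⟩)} :
          Set (PolO n ⧸ IdealO n)) = ⊤ ∧
    (∀ i j, i ≠ j →
      (Submodule.Quotient.mk (vO n i j) : PolO n ⧸ IdealO n) = 0) ∧
    (∀ i j, (Submodule.Quotient.mk (vO n i i) : PolO n ⧸ IdealO n) =
      Submodule.Quotient.mk (vO n j j)) := by
  refine ⟨?_, fun i j hij => ?_, fun i j => ?_⟩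
  · set o : Fin n := ⟨0, by omega⟩
    set S := Submodule.span ℂ ({Submodule.Quotient.mk (1 : PolO n),
      Submodule.Quotient.mk (vO n o o)} : Set (PolO n ⧸ IdealO n))
    have h1 : Submodule.Quotient.mk (1 : PolO n) ∈ S := Submodule.subset_span (by simp)
    have hv : Submodule.Quotient.mk (vO n o o) ∈ S := Submodule.subset_span (by simp)
    have hgen : ∀ i j, ∀ s ∈ S, vO n i j • s ∈ S := by
      intro i j s hs
      induction hs using Submodule.span_induction with
      | mem x hx =>
        rcases hx with rfl | rfl
        · rw [← Submodule.Quotient.mk_smul, smul_eq_mul, mul_one, mk_vO_eq n o]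
          split_ifs
          exacts [hv, S.zero_mem]
        · rw [vO_smul_mk_vO]
          split_ifs
          exacts [h1, S.zero_mem]
      | zero => simp
      | add x y _ _ hx hy =>
        rw [smul_add]
        exact S.add_mem hx hy
      | smul c x _ hx =>
        rw [smul_algebra_smul_comm]
        exact S.smul_mem c hx
    rw [eq_top_iff]
    rintro x -
    obtain ⟨a, rfl⟩ := Submodule.Quotient.mk_surjective _ x
    have h := PolO.smul_mem_of_vO_smul_mem S hgen a h1
    rwa [← Submodule.Quotient.mk_smul, smul_eq_mul, mul_one] at h
  · rw [mk_vO_eq n i, if_neg hij]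
  · rw [mk_vO_eq n j, if_pos rfl]
end

section
/- There is a unique ℂ-algebra homomorphism π : Pol(O_n⁺) → ℂ[ℤ/2ℤ] with π(v_{ij}) = δ_{ij}·g for all i, j, where g ∈ ℂ[ℤ/2ℤ] is the group element corresponding to the generator of ℤ/2ℤ. This π vanishes on the left ideal I, and the induced ℂ-linear map Pol(O_n⁺)/I → ℂ[ℤ/2ℤ] is bijective; it is an isomorphism of left Pol(O_n⁺)-modules, where ℂ[ℤ/2ℤ] carries the left Pol(O_n⁺)-module structure obtained via π. -/
/-- The group element `g` in the group algebra `ℂ[ℤ/2ℤ]` corresponding to the generator of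
`ℤ/2ℤ`. -/
noncomputable def genZ2 : MonoidAlgebra ℂ (Multiplicative (ZMod 2)) :=
  MonoidAlgebra.of ℂ (Multiplicative (ZMod 2)) (Multiplicative.ofAdd 1)

section

variable {n : ℕ}

lemma sum_vO_row (i j : Fin n) :
    ∑ k, vO n i k * vO n j k = if i = j then 1 else 0 := by
  have h := RingQuot.mkAlgHom_rel ℂ (Orel.row i j)
  simpa [vO, apply_ite (RingQuot.mkAlgHom ℂ (Orel n))] using h

lemma vO_mul_vO_sub_mem (i j k l : Fin n) :
    vO n i j * vO n k l - (if i = j ∧ k = l then 1 else 0) ∈ IdealO n :=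
  Submodule.subset_span ⟨i, j, k, l, rfl⟩

/-- Expanding `∑ k, v i k * v j k * v p q` in two ways modulo the left ideal. -/
lemma ite_vO_sub_ite_vO_mem (i j p q : Fin n) :
    (if i = j then vO n p q else 0) - (if p = q then vO n i j else 0) ∈ IdealO n := by
  have h : ∑ k, vO n i k * (vO n j k * vO n p q - if j = k ∧ p = q then 1 else 0) ∈ IdealO n :=
    Submodule.sum_mem _ fun k _ => (IdealO n).smul_mem _ (vO_mul_vO_sub_mem j k p q)
  convert h using 1
  simp only [mul_sub, Finset.sum_sub_distrib, ← mul_assoc, ← Finset.sum_mul, sum_vO_row]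
  by_cases hpq : p = q <;> by_cases hij : i = j <;> simp [hpq, hij]

lemma vO_mem_of_ne {i j : Fin n} (hij : i ≠ j) : vO n i j ∈ IdealO n := by
  simpa [hij] using ite_vO_sub_ite_vO_mem i j i i

lemma vO_diag_sub_mem (i j : Fin n) : vO n i i - vO n j j ∈ IdealO n := by
  simpa using ite_vO_sub_ite_vO_mem j j i i

/-- An induction principle for `Pol(O_n⁺)`. -/
lemma PolO.induction {P : PolO n → Prop} (hc : ∀ c : ℂ, P (algebraMap ℂ _ c))
    (hv : ∀ i j, P (vO n i j)) (hm : ∀ a b, P a → P b → P (a * b))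
    (ha : ∀ a b, P a → P b → P (a + b)) (x : PolO n) : P x := by
  obtain ⟨y, rfl⟩ := RingQuot.mkAlgHom_surjective ℂ (Orel n) x
  induction y using FreeAlgebra.induction with
  | grade0 c => simpa using hc c
  | grade1 x => obtain ⟨i, j⟩ := x; exact hv i j
  | mul a b h₁ h₂ => rw [map_mul]; exact hm _ _ h₁ h₂
  | add a b h₁ h₂ => rw [map_add]; exact ha _ _ h₁ h₂

/-- Modulo the left ideal, `Pol(O_n⁺)` is spanned by `1` and any diagonal generator. -/
lemma exists_sub_mem_IdealO (i₀ : Fin n) (x : PolO n) :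
    ∃ a b : ℂ, x - (a • 1 + b • vO n i₀ i₀) ∈ IdealO n := by
  suffices h : ∀ x s : PolO n, (∃ a b : ℂ, s - (a • 1 + b • vO n i₀ i₀) ∈ IdealO n) →
      ∃ a b : ℂ, x * s - (a • 1 + b • vO n i₀ i₀) ∈ IdealO n by
    simpa using h x 1 ⟨1, 0, by simp⟩
  intro x
  induction x using PolO.induction with
  | hc c =>
    rintro s ⟨a, b, h⟩
    refine ⟨c * a, c * b, ?_⟩
    convert (IdealO n).smul_mem (algebraMap ℂ (PolO n) c) h using 1
    simp [mul_sub, mul_add, Algebra.smul_def, mul_assoc]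
  | hv i j =>
    rintro s ⟨a, b, h⟩
    have h₁ := (IdealO n).smul_mem (vO n i j) h
    have h₂ := (IdealO n).smul_mem (algebraMap ℂ (PolO n) b) (vO_mul_vO_sub_mem i j i₀ i₀)
    rw [← algebraMap_smul (PolO n) a, ← algebraMap_smul (PolO n) b] at h₁
    simp only [smul_eq_mul, mul_sub, mul_add, mul_one, ← mul_assoc,
      ← Algebra.commutes _ (vO n i j)] at h₁ h₂
    by_cases hij : i = j
    · subst hij
      have h₃ := (IdealO n).smul_mem (algebraMap ℂ (PolO n) a) (vO_diag_sub_mem i i₀)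
      refine ⟨b, a, ?_⟩
      convert add_mem h₁ (add_mem h₂ h₃) using 1
      simp only [Algebra.smul_def, smul_eq_mul, mul_sub, mul_one, and_self, if_true]
      abel
    · have h₃ := (IdealO n).smul_mem (algebraMap ℂ (PolO n) a) (vO_mem_of_ne hij)
      refine ⟨0, 0, ?_⟩
      convert add_mem h₁ (add_mem h₂ h₃) using 1
      simp only [hij, false_and, if_false, mul_zero, sub_zero, zero_smul, add_zero, smul_eq_mul]
      abel
  | hm a b ha hb =>
    intro s hs
    rw [mul_assoc]
    exact ha _ (hb _ hs)
  | ha x y hx hy =>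
    intro s hs
    obtain ⟨a, b, h₁⟩ := hx s hs
    obtain ⟨c, d, h₂⟩ := hy s hs
    refine ⟨a + c, b + d, ?_⟩
    convert add_mem h₁ h₂ using 1
    simp only [add_mul, add_smul]
    abel

lemma genZ2_mul_self : genZ2 * genZ2 = 1 := by
  rw [genZ2, ← map_mul, ← map_one (MonoidAlgebra.of ℂ (Multiplicative (ZMod 2)))]
  congr 1

lemma eq_smul_one_add_smul_genZ2 (y : MonoidAlgebra ℂ (Multiplicative (ZMod 2))) :
    y = y.coeff 1 • 1 + y.coeff (Multiplicative.ofAdd 1) • genZ2 := by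
  refine MonoidAlgebra.ext (Finsupp.ext fun g => ?_)
  obtain rfl | rfl : g = 1 ∨ g = Multiplicative.ofAdd 1 := by revert g; decide
  all_goals simp [genZ2, MonoidAlgebra.one_def]

lemma eq_zero_of_smul_one_add_smul_genZ2_eq_zero {a b : ℂ}
    (h : a • (1 : MonoidAlgebra ℂ (Multiplicative (ZMod 2))) + b • genZ2 = 0) :
    a = 0 ∧ b = 0 := by
  constructor
  · simpa [genZ2, MonoidAlgebra.one_def] using DFunLike.congr_fun (congrArg MonoidAlgebra.coeff h) 1
  · simpa [genZ2, MonoidAlgebra.one_def] using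
      DFunLike.congr_fun (congrArg MonoidAlgebra.coeff h) (Multiplicative.ofAdd 1)

/-- The homomorphism `Pol(O_n⁺) → ℂ[ℤ/2ℤ]` sending `v i j` to `δ_{ij} g`. -/
noncomputable def PolO.toGroupAlgebra (n : ℕ) :
    PolO n →ₐ[ℂ] MonoidAlgebra ℂ (Multiplicative (ZMod 2)) :=
  RingQuot.liftAlgHom ℂ ⟨FreeAlgebra.lift ℂ fun
    | .v i j => if i = j then genZ2 else 0, by
      rintro _ _ (⟨i, j⟩ | ⟨i, j⟩) <;> simp [genZ2_mul_self, eq_comm]⟩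

lemma PolO.toGroupAlgebra_vO (i j : Fin n) :
    PolO.toGroupAlgebra n (vO n i j) = if i = j then genZ2 else 0 := by
  simp [PolO.toGroupAlgebra, vO]

lemma PolO.algHom_ext {A : Type*} [Semiring A] [Algebra ℂ A] {f g : PolO n →ₐ[ℂ] A}
    (h : ∀ i j, f (vO n i j) = g (vO n i j)) : f = g := by
  ext x
  obtain ⟨i, j⟩ := x
  exact h i j

end

/-- There is a unique `ℂ`-algebra homomorphism `π : Pol(O_n⁺) → ℂ[ℤ/2ℤ]` with
`π (v i j) = δ_{ij} g`; it vanishes on the left ideal `I`, and the induced map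
`Pol(O_n⁺)/I → ℂ[ℤ/2ℤ]` is a bijection, `Pol(O_n⁺)`-linear when `ℂ[ℤ/2ℤ]` is regarded
as a left `Pol(O_n⁺)`-module via `π` (i.e. `a • m = π a * m`). -/
theorem polO_quotient_iso_groupAlgebra
    (n : ℕ) (hn : 2 ≤ n) :
    (∃! π : PolO n →ₐ[ℂ] MonoidAlgebra ℂ (Multiplicative (ZMod 2)),
      ∀ i j, π (vO n i j) = if i = j then genZ2 else 0) ∧
    ∀ π : PolO n →ₐ[ℂ] MonoidAlgebra ℂ (Multiplicative (ZMod 2)),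
      (∀ i j, π (vO n i j) = if i = j then genZ2 else 0) →
      (∀ x ∈ IdealO n, π x = 0) ∧
      ∃ ψ : (PolO n ⧸ IdealO n) →ₗ[ℂ] MonoidAlgebra ℂ (Multiplicative (ZMod 2)),
        Function.Bijective ψ ∧
        (∀ x : PolO n, ψ (Submodule.Quotient.mk x) = π x) ∧
        ∀ (a : PolO n) (q : PolO n ⧸ IdealO n), ψ (a • q) = π a * ψ q := by
  refine ⟨⟨PolO.toGroupAlgebra n, PolO.toGroupAlgebra_vO, fun π hπ =>
    PolO.algHom_ext fun i j => by rw [hπ, PolO.toGroupAlgebra_vO]⟩, fun π hπ => ?_⟩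
  have hI : ∀ x ∈ IdealO n, π x = 0 := by
    intro x hx
    induction hx using Submodule.span_induction with
    | mem x hx =>
      obtain ⟨i, j, k, l, rfl⟩ := hx
      by_cases hij : i = j <;> by_cases hkl : k = l <;> simp [hπ, hij, hkl, genZ2_mul_self]
    | zero => exact map_zero π
    | add x y _ _ hx hy => rw [map_add, hx, hy, add_zero]
    | smul a x _ hx => rw [smul_eq_mul, map_mul, hx, mul_zero]
  let ψ : (PolO n ⧸ IdealO n) →ₗ[ℂ] MonoidAlgebra ℂ (Multiplicative (ZMod 2)) :=
    ((IdealO n).restrictScalars ℂ).liftQ π.toLinearMap hI ∘ₗ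
      (Submodule.Quotient.restrictScalarsEquiv ℂ (IdealO n)).symm.toLinearMap
  have hψ : ∀ x : PolO n, ψ (Submodule.Quotient.mk x) = π x := fun _ => rfl
  let i₀ : Fin n := ⟨0, by omega⟩
  have hπ₀ : π (vO n i₀ i₀) = genZ2 := by simp [hπ]
  refine ⟨hI, ψ, ⟨?_, fun y => ?_⟩, hψ, fun a q => ?_⟩
  · rw [injective_iff_map_eq_zero]
    intro q hq
    obtain ⟨x, rfl⟩ := Submodule.Quotient.mk_surjective _ q
    rw [hψ] at hq
    obtain ⟨a, b, hx⟩ := exists_sub_mem_IdealO i₀ x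
    have h := hI _ hx
    rw [map_sub, hq, zero_sub, neg_eq_zero, map_add, map_smul, map_smul, map_one, hπ₀] at h
    obtain ⟨rfl, rfl⟩ := eq_zero_of_smul_one_add_smul_genZ2_eq_zero h
    simpa [Submodule.Quotient.mk_eq_zero] using hx
  · refine ⟨Submodule.Quotient.mk
      (y.coeff 1 • 1 + y.coeff (Multiplicative.ofAdd 1) • vO n i₀ i₀), ?_⟩
    rw [hψ, map_add, map_smul, map_smul, map_one π, hπ₀]
    exact (eq_smul_one_add_smul_genZ2 y).symm
  · obtain ⟨x, rfl⟩ := Submodule.Quotient.mk_surjective _ q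
    rw [← Submodule.Quotient.mk_smul, hψ, hψ, smul_eq_mul, map_mul]
end
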